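/- arXiv:2510.20648 — 2 statements merged into one kernel-verified Lean document; each statement's English description precedes it below -/
import Mathlib

section
/- The double integral over the simplex Δ = {(x,y) : x, y, 1-x-y ≥ 0} of x²y²/(1-x²-y²) equals -5/48 + G/8, where G is the Catalan constant. -/
open MeasureTheory

lemma aux_arctan_le {t : ℝ} (ht : 0 ≤ t) : Real.arctan t ≤ t := by
  have h := Real.le_tan (Real.arctan_nonneg.2 ht) (Real.arctan_lt_pi_div_two t)
  rwa [Real.tan_arctan] at h

lemma aux_inner (a b : ℝ) (hb : 0 ≤ b) (hab : b < a) :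
    ∫ y in (0:ℝ)..b, y ^ 2 / (a ^ 2 - y ^ 2) =
      -b + a / 2 * (Real.log (a + b) - Real.log (a - b)) := by
  have hpos : ∀ y ∈ Set.uIcc 0 b, 0 < a + y ∧ 0 < a - y := by
    intro y hy
    rw [Set.uIcc_of_le hb] at hy
    constructor <;> linarith [hy.1, hy.2]
  have hne : ∀ y ∈ Set.uIcc 0 b, a ^ 2 - y ^ 2 ≠ 0 := by
    intro y hy
    have h := hpos y hy
    have := mul_pos h.1 h.2
    nlinarith
  rw [intervalIntegral.integral_eq_sub_of_hasDerivAt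
    (f := fun y => -y + a / 2 * (Real.log (a + y) - Real.log (a - y)))]
  · simp
  · intro y hy
    have h := hpos y hy
    have h1 : HasDerivAt (fun y : ℝ => Real.log (a + y)) (1 / (a + y)) y :=
      ((hasDerivAt_id y).const_add a).log h.1.ne'
    have h2 : HasDerivAt (fun y : ℝ => Real.log (a - y)) (-1 / (a - y)) y :=
      ((hasDerivAt_id y).const_sub a).log h.2.ne'
    have h3 := (hasDerivAt_id y).neg.add ((h1.sub h2).const_mul (a / 2))
    refine h3.congr_deriv ?_
    have h4 := h.1.ne'
    have h5 := h.2.ne'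
    have h6 : a ^ 2 - y ^ 2 = (a + y) * (a - y) := by ring
    rw [h6]
    field_simp
    ring
  · apply ContinuousOn.intervalIntegrable
    apply ContinuousOn.div (by fun_prop) (by fun_prop) hne

lemma aux_catalan_integrable :
    IntegrableOn (fun t : ℝ => Real.arctan t / t) (Set.Ioo 0 1) := by
  apply Measure.integrableOn_of_bounded (M := 1) (by simp)
  · exact (Real.measurable_arctan.div measurable_id).aestronglyMeasurable
  · refine (ae_restrict_iff' measurableSet_Ioo).2 (Filter.Eventually.of_forall ?_)
    intro t ht
    have h0 : 0 ≤ Real.arctan t := Real.arctan_nonneg.2 ht.1.le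
    have h1 : Real.arctan t ≤ t := aux_arctan_le ht.1.le
    rw [Real.norm_eq_abs, abs_of_nonneg (div_nonneg h0 ht.1.le)]
    exact (div_le_one ht.1).2 h1

lemma aux_catalan :
    ∫ t in Set.Ioo (0:ℝ) 1, Real.arctan t / t = ∑' n : ℕ, (-1 : ℝ) ^ n / (2 * n + 1) ^ 2 := by
  have hint : ∀ n : ℕ, ∫ t in Set.Ioo (0:ℝ) 1, t ^ (2 * n) = 1 / (2 * n + 1) := by
    intro n
    rw [← integral_Ioc_eq_integral_Ioo, ← intervalIntegral.integral_of_le zero_le_one]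
    simp
  have hI : ∀ n : ℕ, IntegrableOn (fun t : ℝ => t ^ (2 * n)) (Set.Ioo 0 1) := by
    intro n
    exact ((by fun_prop : Continuous fun t : ℝ => t ^ (2 * n)).integrableOn_Icc).mono_set
      Set.Ioo_subset_Icc_self
  have key := hasSum_integral_of_summable_integral_norm
    (μ := volume.restrict (Set.Ioo (0:ℝ) 1))
    (F := fun (n : ℕ) (t : ℝ) => ((-1 : ℝ) ^ n / (2 * n + 1)) * t ^ (2 * n))
    (fun n => (hI n).const_mul _) ?_
  · have e1 : ∀ n : ℕ, ∫ t in Set.Ioo (0:ℝ) 1, ((-1 : ℝ) ^ n / (2 * n + 1)) * t ^ (2 * n)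
        = (-1 : ℝ) ^ n / (2 * n + 1) ^ 2 := by
      intro n
      rw [integral_const_mul, hint]
      have : (2 * (n:ℝ) + 1) ≠ 0 := by positivity
      field_simp
    simp only [e1] at key
    rw [key.tsum_eq]
    apply setIntegral_congr_fun measurableSet_Ioo
    intro t ht
    have h := Real.hasSum_arctan (x := t) (by rw [Real.norm_eq_abs, abs_lt]; constructor <;> linarith [ht.1, ht.2])
    have h2 := h.div_const t
    simp only
    rw [← h2.tsum_eq]
    congr 1
    ext n
    have := ht.1.ne'
    have : (2 * (n:ℝ) + 1) ≠ 0 := by positivity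
    push_cast
    field_simp
    ring
  · have e2 : ∀ n : ℕ, ∫ t in Set.Ioo (0:ℝ) 1, ‖((-1 : ℝ) ^ n / (2 * n + 1)) * t ^ (2 * n)‖
        = 1 / (2 * n + 1) ^ 2 := by
      intro n
      have : ∀ t : ℝ, ‖((-1 : ℝ) ^ n / (2 * n + 1)) * t ^ (2 * n)‖
          = (1 / (2 * n + 1)) * t ^ (2 * n) := by
        intro t
        have h : 0 ≤ 2 * (n:ℝ) + 1 := by positivity
        rw [norm_mul, norm_div, norm_pow, norm_neg, norm_one, one_pow, Real.norm_of_nonneg h,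
          Real.norm_of_nonneg ((even_two_mul n).pow_nonneg t)]
      simp only [this]
      rw [integral_const_mul, hint]
      have : (2 * (n:ℝ) + 1) ≠ 0 := by positivity
      field_simp
    simp only [e2]
    have hs : Summable fun n : ℕ => 1 / (((n + 1 : ℕ) : ℝ)) ^ 2 :=
      (summable_nat_add_iff 1).2 (Real.summable_one_div_nat_pow.2 one_lt_two)
    refine Summable.of_nonneg_of_le (fun n => by positivity) (fun n => ?_) hs
    push_cast
    gcongr
    have : (0:ℝ) ≤ n := by positivity
    linarith

lemma aux_log_arctan : Continuous fun t : ℝ => Real.arctan t * Real.log t := by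
  rw [continuous_iff_continuousAt]
  intro t
  by_cases ht : t = 0
  · subst ht
    unfold ContinuousAt
    have h : Filter.Tendsto (fun t : ℝ => |t * Real.log t|) (nhds 0) (nhds 0) := by
      have := (Real.continuous_mul_log.abs).tendsto 0
      simpa using this
    simp only [Real.arctan_zero, zero_mul]
    refine squeeze_zero_norm (fun t => ?_) h
    rw [Real.norm_eq_abs, abs_mul, abs_mul]
    refine mul_le_mul_of_nonneg_right ?_ (abs_nonneg _)
    rcases le_total 0 t with h0 | h0
    · rw [abs_of_nonneg h0, abs_of_nonneg (Real.arctan_nonneg.2 h0)]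
      exact aux_arctan_le h0
    · have := aux_arctan_le (neg_nonneg.2 h0)
      rw [Real.arctan_neg] at this
      have h1 : Real.arctan t ≤ 0 := by
        have := Real.arctan_nonneg.2 (neg_nonneg.2 h0)
        rw [Real.arctan_neg] at this
        linarith
      rw [abs_of_nonpos h0, abs_of_nonpos h1]
      exact this
  · exact (Real.continuous_arctan.continuousAt).mul (Real.continuousAt_log ht)

lemma aux_outer :
    ∫ t in Set.Ioo (0:ℝ) 1,
      ((2 * t / (1 + t ^ 2)) ^ 2 * (-(1 - 2 * t / (1 + t ^ 2))) * (2 * (1 - t ^ 2) / (1 + t ^ 2) ^ 2)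
        - 4 * t * (1 - t ^ 2) ^ 2 / (1 + t ^ 2) ^ 5 * (t * Real.log t)) =
      -5 / 48 + (∑' n : ℕ, (-1 : ℝ) ^ n / (2 * n + 1) ^ 2) / 8 := by
  have hw : ∀ t : ℝ, 1 + t ^ 2 ≠ 0 := fun t => by positivity
  set f : ℝ → ℝ := fun t => ((2 * t / (1 + t ^ 2)) ^ 2 * (-(1 - 2 * t / (1 + t ^ 2))) * (2 * (1 - t ^ 2) / (1 + t ^ 2) ^ 2)
        - 4 * t * (1 - t ^ 2) ^ 2 / (1 + t ^ 2) ^ 5 * (t * Real.log t)) with hf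
  have hfc : Continuous f := by
    have := Real.continuous_mul_log
    have hw2 : ∀ t : ℝ, (1 + t ^ 2) ^ 2 ≠ 0 := fun t => by positivity
    have hw5 : ∀ t : ℝ, (1 + t ^ 2) ^ 5 ≠ 0 := fun t => by positivity
    refine Continuous.sub ?_ (Continuous.mul ?_ this)
    · fun_prop (disch := assumption)
    · fun_prop (disch := assumption)
  have hfi : IntegrableOn f (Set.Ioo 0 1) :=
    hfc.integrableOn_Icc.mono_set Set.Ioo_subset_Icc_self
  have hai := aux_catalan_integrable.div_const 8
  have main : ∫ t in Set.Ioo (0:ℝ) 1, (f t - Real.arctan t / t / 8) = -5 / 48 := by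
    rw [← integral_Ioc_eq_integral_Ioo, ← intervalIntegral.integral_of_le zero_le_one]
    let X : ℝ → ℝ := fun t => 2 * t / (1 + t ^ 2)
    let Q : ℝ → ℝ := fun t => (1 / 8) * ((1 - t ^ 2) / (1 + t ^ 2) ^ 2 * (1 - 8 * t ^ 2 / (1 + t ^ 2) ^ 2))
    let Ψ : ℝ → ℝ := fun t => (-(X t) ^ 3 / 3 + (X t) ^ 4 / 4) -
      ((1 / 8) * (Real.arctan t * Real.log t) - Q t * (t * Real.log t))
      - (1 / 16) * (X t - 2 * (X t) ^ 3 / 3)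
    rw [intervalIntegral.integral_eq_sub_of_hasDerivAt_of_le (f := Ψ) zero_le_one]
    · simp [Ψ, X, Q]
      norm_num
    · have h1 := Real.continuous_mul_log
      have h2 := aux_log_arctan
      have hX : Continuous X := by
        simp only [X]
        fun_prop (disch := assumption)
      have hw2 : ∀ t : ℝ, (1 + t ^ 2) ^ 2 ≠ 0 := fun t => by positivity
      have hQ : Continuous Q := by
        simp only [Q]
        fun_prop (disch := assumption)
      apply Continuous.continuousOn
      simp only [Ψ]
      have h3 := hQ.mul h1
      have h4 := continuous_const (y := (1/8:ℝ)) |>.mul h2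
      exact (Continuous.sub (by fun_prop) (h4.sub h3)).sub (by fun_prop)
    · intro t ht
      have ht0 := ht.1.ne'
      have hw' := hw t
      have hsq : HasDerivAt (fun t : ℝ => t ^ 2) (2 * t) t := by
        simpa using hasDerivAt_pow 2 t
      have hW : HasDerivAt (fun t : ℝ => 1 + t ^ 2) (2 * t) t := hsq.const_add 1
      have hV : HasDerivAt (fun t : ℝ => 1 - t ^ 2) (-(2 * t)) t := hsq.const_sub 1
      have hX : HasDerivAt X (2 * (1 - t ^ 2) / (1 + t ^ 2) ^ 2) t := by
        refine (((hasDerivAt_id t).const_mul 2).div hW hw').congr_deriv ?_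
        simp only [id]
        field_simp
        ring
      have hL := Real.hasDerivAt_log ht0
      have hT := Real.hasDerivAt_arctan t
      have hQ := ((hV.div (hW.pow 2) (pow_ne_zero 2 hw')).mul
        (((hsq.const_mul 8).div (hW.pow 2) (pow_ne_zero 2 hw')).const_sub 1)).const_mul (1 / 8 : ℝ)
      have h := ((((hX.pow 3).neg.div_const 3).add ((hX.pow 4).div_const 4)).sub
        (((hT.mul hL).const_mul (1 / 8 : ℝ)).sub (hQ.mul ((hasDerivAt_id t).mul hL)))).sub
        ((hX.sub (((hX.pow 3).const_mul 2).div_const 3)).const_mul (1 / 16 : ℝ))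
      refine h.congr_deriv ?_
      simp only [f, X, id, Pi.pow_apply, Pi.div_apply, Pi.mul_apply, Pi.sub_apply]
      push_cast
      generalize Real.log t = l
      generalize Real.arctan t = m
      field_simp
      ring
    · rw [intervalIntegrable_iff_integrableOn_Ioo_of_le zero_le_one]
      exact hfi.sub hai
  have h2 : ∫ t in Set.Ioo (0:ℝ) 1, (f t - Real.arctan t / t / 8) =
      (∫ t in Set.Ioo (0:ℝ) 1, f t) - ∫ t in Set.Ioo (0:ℝ) 1, Real.arctan t / t / 8 :=
    integral_sub hfi hai
  rw [integral_div, aux_catalan] at h2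
  linarith

lemma aux_image : (fun t : ℝ => 2 * t / (1 + t ^ 2)) '' Set.Ioo 0 1 = Set.Ioo 0 1 := by
  ext x
  constructor
  · rintro ⟨t, ht, rfl⟩
    have := ht.1
    have h2 : 0 < (1 - t) ^ 2 := by have := ht.2; have : 0 < 1 - t := by linarith
                                    positivity
    refine ⟨by positivity, ?_⟩
    simp only
    rw [div_lt_one (by positivity)]
    nlinarith
  · rintro ⟨h0, h1⟩
    have hc : ContinuousOn (fun t : ℝ => 2 * t / (1 + t ^ 2)) (Set.Icc 0 1) := by
      have hw : ∀ t : ℝ, 1 + t ^ 2 ≠ 0 := fun t => by positivity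
      apply Continuous.continuousOn
      fun_prop (disch := assumption)
    have := intermediate_value_Ioo (zero_le_one (α := ℝ)) hc
    apply this
    norm_num
    exact ⟨h0, h1⟩

lemma aux_subst (g : ℝ → ℝ) : ∫ x in Set.Ioo (0:ℝ) 1, g x =
    ∫ t in Set.Ioo (0:ℝ) 1, (2 * (1 - t ^ 2) / (1 + t ^ 2) ^ 2) * g (2 * t / (1 + t ^ 2)) := by
  conv_lhs => rw [← aux_image]
  rw [integral_image_eq_integral_abs_deriv_smul (f' := fun t => 2 * (1 - t ^ 2) / (1 + t ^ 2) ^ 2)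
    measurableSet_Ioo]
  · apply setIntegral_congr_fun measurableSet_Ioo
    intro t ht
    have h : 0 ≤ 1 - t ^ 2 := by nlinarith [ht.1, ht.2]
    simp only [smul_eq_mul]
    rw [abs_of_nonneg (by positivity)]
  · intro t ht
    have hw' : 1 + t ^ 2 ≠ 0 := by positivity
    have hsq : HasDerivAt (fun t : ℝ => t ^ 2) (2 * t) t := by
      simpa using hasDerivAt_pow 2 t
    have hW : HasDerivAt (fun t : ℝ => 1 + t ^ 2) (2 * t) t := hsq.const_add 1
    refine HasDerivAt.hasDerivWithinAt ?_
    refine (((hasDerivAt_id t).const_mul 2).div hW hw').congr_deriv ?_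
    simp only [id]
    field_simp
    ring
  · intro s hs t ht h
    simp only at h
    have h1 : 1 + s ^ 2 ≠ 0 := by positivity
    have h2 : 1 + t ^ 2 ≠ 0 := by positivity
    rw [div_eq_div_iff h1 h2] at h
    have h3 : (s - t) * (1 - s * t) = 0 := by linarith
    have h4 : s * t < 1 := by nlinarith [hs.1, hs.2, ht.1, ht.2]
    rcases mul_eq_zero.1 h3 with h | h <;> linarith

theorem integral_simplex_x2y2 :
    ∫ p : ℝ × ℝ in {p : ℝ × ℝ | 0 ≤ p.1 ∧ 0 ≤ p.2 ∧ 0 ≤ 1 - p.1 - p.2},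
        p.1 ^ 2 * p.2 ^ 2 / (1 - p.1 ^ 2 - p.2 ^ 2) =
      -5 / 48 + (∑' n : ℕ, (-1 : ℝ) ^ n / (2 * n + 1) ^ 2) / 8 := by
  set S : Set (ℝ × ℝ) := {p : ℝ × ℝ | 0 ≤ p.1 ∧ 0 ≤ p.2 ∧ 0 ≤ 1 - p.1 - p.2} with hS
  have hSm : MeasurableSet S := by
    apply IsClosed.measurableSet
    have c1 : IsClosed {p : ℝ × ℝ | 0 ≤ p.1} := isClosed_le (by fun_prop) (by fun_prop)
    have c2 : IsClosed {p : ℝ × ℝ | 0 ≤ p.2} := isClosed_le (by fun_prop) (by fun_prop)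
    have c3 : IsClosed {p : ℝ × ℝ | 0 ≤ 1 - p.1 - p.2} := isClosed_le (by fun_prop) (by fun_prop)
    exact c1.inter (c2.inter c3)
  have hSsub : S ⊆ Set.Icc 0 1 ×ˢ Set.Icc 0 1 := by
    rintro ⟨x, y⟩ ⟨h1, h2, h3⟩
    simp only at h1 h2 h3
    exact ⟨⟨h1, by simp only; linarith⟩, ⟨h2, by simp only; linarith⟩⟩
  have hfin : volume S ≠ ⊤ := by
    refine ne_top_of_le_ne_top ?_ (measure_mono hSsub)
    exact (isCompact_Icc.prod isCompact_Icc).measure_lt_top.ne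
  have hint : IntegrableOn (fun p : ℝ × ℝ => p.1 ^ 2 * p.2 ^ 2 / (1 - p.1 ^ 2 - p.2 ^ 2)) S := by
    apply Measure.integrableOn_of_bounded (M := 1) hfin
    · apply Measurable.aestronglyMeasurable
      fun_prop
    · refine (ae_restrict_iff' hSm).2 (Filter.Eventually.of_forall ?_)
      rintro ⟨x, y⟩ ⟨h1, h2, h3⟩
      simp only at h1 h2 h3 ⊢
      have hxy : 0 ≤ x * y := mul_nonneg h1 h2
      have hd : 2 * (x * y) ≤ 1 - x ^ 2 - y ^ 2 := by nlinarith
      have hd0 : 0 ≤ 1 - x ^ 2 - y ^ 2 := by linarith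
      rw [Real.norm_of_nonneg (by positivity)]
      apply div_le_one_of_le₀ _ hd0
      have : x * y ≤ 1 := by nlinarith
      nlinarith
  rw [← integral_indicator hSm, Measure.volume_eq_prod, integral_prod _
    ((integrable_indicator_iff hSm).2 hint)]
  have hx : ∀ x : ℝ, x ≠ 0 → x ≠ 1 → ∫ y, S.indicator (fun p : ℝ × ℝ => p.1 ^ 2 * p.2 ^ 2 / (1 - p.1 ^ 2 - p.2 ^ 2)) (x, y)
      = (Set.Ioo (0:ℝ) 1).indicator (fun x => ∫ y in (0:ℝ)..(1 - x), x ^ 2 * y ^ 2 / (1 - x ^ 2 - y ^ 2)) x := by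
    intro x hx0 hx1
    by_cases hx : x ∈ Set.Ioo (0:ℝ) 1
    · rw [Set.indicator_of_mem hx, intervalIntegral.integral_of_le (by linarith [hx.2]),
        ← integral_Icc_eq_integral_Ioc, ← integral_indicator measurableSet_Icc]
      congr 1
      ext y
      by_cases hy : y ∈ Set.Icc 0 (1 - x)
      · rw [Set.indicator_of_mem hy, Set.indicator_of_mem]
        exact ⟨hx.1.le, hy.1, by simp only; linarith [hy.2]⟩
      · rw [Set.indicator_of_notMem hy, Set.indicator_of_notMem]
        rintro ⟨h1, h2, h3⟩
        simp only at h1 h2 h3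
        exact hy ⟨h2, by linarith⟩
    · rw [Set.indicator_of_notMem hx]
      have : ∀ y, S.indicator (fun p : ℝ × ℝ => p.1 ^ 2 * p.2 ^ 2 / (1 - p.1 ^ 2 - p.2 ^ 2)) (x, y) = 0 := by
        intro y
        apply Set.indicator_of_notMem
        rintro ⟨h1, h2, h3⟩
        simp only at h1 h2 h3
        exact hx ⟨lt_of_le_of_ne h1 (Ne.symm hx0), lt_of_le_of_ne (by linarith) hx1⟩
      simp [this]
  have hae : ∀ᵐ x : ℝ, ∫ y, S.indicator (fun p : ℝ × ℝ => p.1 ^ 2 * p.2 ^ 2 / (1 - p.1 ^ 2 - p.2 ^ 2)) (x, y)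
      = (Set.Ioo (0:ℝ) 1).indicator (fun x => ∫ y in (0:ℝ)..(1 - x), x ^ 2 * y ^ 2 / (1 - x ^ 2 - y ^ 2)) x := by
    filter_upwards [Measure.ae_ne volume (0:ℝ), Measure.ae_ne volume (1:ℝ)] with x h0 h1 using hx x h0 h1
  rw [integral_congr_ae hae, integral_indicator measurableSet_Ioo, aux_subst, ← aux_outer]
  apply setIntegral_congr_fun measurableSet_Ioo
  intro t ht
  have ht0 := ht.1
  have ht1 : 0 < 1 - t := by linarith [ht.2]
  have hw : 1 + t ^ 2 ≠ 0 := by positivity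
  have hwp : 0 < 1 + t ^ 2 := by positivity
  simp only
  have e : ∀ y : ℝ, (2 * t / (1 + t ^ 2)) ^ 2 * y ^ 2 / (1 - (2 * t / (1 + t ^ 2)) ^ 2 - y ^ 2) =
      (2 * t / (1 + t ^ 2)) ^ 2 * (y ^ 2 / (((1 - t ^ 2) / (1 + t ^ 2)) ^ 2 - y ^ 2)) := by
    intro y
    have : 1 - (2 * t / (1 + t ^ 2)) ^ 2 = ((1 - t ^ 2) / (1 + t ^ 2)) ^ 2 := by
      field_simp
      ring
    rw [this, mul_div_assoc]
  simp only [e]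
  have e1 : 1 - 2 * t / (1 + t ^ 2) = (1 - t) ^ 2 / (1 + t ^ 2) := by
    field_simp
    ring
  have e2 : (1 - t ^ 2) / (1 + t ^ 2) + (1 - 2 * t / (1 + t ^ 2)) = 2 * (1 - t) / (1 + t ^ 2) := by
    field_simp
    ring
  have e3 : (1 - t ^ 2) / (1 + t ^ 2) - (1 - 2 * t / (1 + t ^ 2)) = t * (2 * (1 - t) / (1 + t ^ 2)) := by
    field_simp
    ring
  have hp : 0 < 2 * (1 - t) / (1 + t ^ 2) := by positivity
  rw [intervalIntegral.integral_const_mul, aux_inner]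
  · rw [e2, e3, Real.log_mul ht0.ne' hp.ne']
    generalize Real.log t = l
    field_simp
    ring
  · rw [e1]; positivity
  · have := mul_pos ht0 hp
    linarith
end

section
/- The double integral over the simplex Δ = {(x,y) : x, y, 1-x-y ≥ 0} of x⁴y⁴/(1-x²-y²) equals -569/26880 + (3/128)·G, where G is the Catalan constant. -/
open MeasureTheory

noncomputable def arcD (x : ℝ) : ℝ := dslope Real.arctan 0 x

lemma arcD_cont : Continuous arcD := by
  rw [continuous_iff_continuousAt]
  intro x
  unfold arcD
  by_cases h : x = 0
  · subst h
    exact continuousAt_dslope_same.2 (Real.hasDerivAt_arctan 0).differentiableAt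
  · exact (continuousAt_dslope_of_ne h).2 Real.continuous_arctan.continuousAt

lemma arcD_mul (x : ℝ) : x * arcD x = Real.arctan x := by
  have := sub_smul_dslope Real.arctan 0 x
  simpa [arcD] using this

noncomputable def Ti (u : ℝ) : ℝ := ∫ v in (0:ℝ)..u, arcD v

lemma Ti_deriv (u : ℝ) : HasDerivAt Ti (arcD u) u :=
  intervalIntegral.integral_hasDerivAt_right (arcD_cont.intervalIntegrable _ _)
    (arcD_cont.stronglyMeasurableAtFilter _ _) arcD_cont.continuousAt

lemma Ti_cont : Continuous Ti :=
  continuous_iff_continuousAt.2 fun u => (Ti_deriv u).continuousAt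

lemma Ti_one : Ti 1 = ∑' n : ℕ, (-1 : ℝ) ^ n / (2 * n + 1) ^ 2 := by
  have hpow : ∀ n : ℕ, ∫ x in Set.Ioo (0:ℝ) 1, x ^ (2*n) = 1 / (2 * n + 1) := by
    intro n
    rw [← integral_Ioc_eq_integral_Ioo, ← intervalIntegral.integral_of_le zero_le_one]
    simp
  have key := hasSum_integral_of_summable_integral_norm
    (μ := volume.restrict (Set.Ioo (0:ℝ) 1))
    (F := fun (n : ℕ) (x : ℝ) => ((-1 : ℝ) ^ n / (2 * n + 1)) * x ^ (2*n)) ?_ ?_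
  · have e : ∫ x in Set.Ioo (0:ℝ) 1, ∑' n : ℕ, ((-1 : ℝ) ^ n / (2 * n + 1)) * x ^ (2*n) = Ti 1 := by
      unfold Ti
      rw [intervalIntegral.integral_of_le zero_le_one, integral_Ioc_eq_integral_Ioo]
      refine setIntegral_congr_fun measurableSet_Ioo fun x hx => ?_
      have h1 := Real.hasSum_arctan (x := x) (by rw [Real.norm_eq_abs, abs_lt]; constructor <;> linarith [hx.1, hx.2])
      have hx0 : x ≠ 0 := hx.1.ne'
      have h2 := h1.mul_left x⁻¹
      have h3 : x⁻¹ * Real.arctan x = arcD x := by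
        rw [← arcD_mul]; field_simp
      rw [h3] at h2
      rw [← h2.tsum_eq]
      congr 1; ext n
      push_cast
      field_simp
      ring
    rw [e] at key
    rw [← key.tsum_eq]
    congr 1; ext n
    rw [integral_const_mul, hpow]
    field_simp
  · intro n
    refine Integrable.const_mul ?_ _
    exact ((continuous_pow _).integrableOn_Icc (a := 0) (b := 1)).mono_set Set.Ioo_subset_Icc_self
  · have : ∀ n : ℕ, ∫ x in Set.Ioo (0:ℝ) 1, ‖((-1 : ℝ) ^ n / (2 * n + 1)) * x ^ (2*n)‖ = 1 / (2*n+1)^2 := by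
      intro n
      have : ∀ x : ℝ, ‖((-1 : ℝ) ^ n / (2 * n + 1)) * x ^ (2*n)‖ = (1 / (2 * n + 1)) * x ^ (2*n) := by
        intro x
        rw [norm_mul, norm_div, norm_pow, norm_neg, norm_one, one_pow, Real.norm_of_nonneg (by positivity),
          Real.norm_of_nonneg (by rw [pow_mul]; positivity)]
      simp_rw [this]
      rw [integral_const_mul, hpow]
      field_simp
    simp_rw [this]
    have hs := (Real.summable_one_div_nat_pow (p := 2)).2 (by norm_num)
    have := hs.comp_injective (i := fun n : ℕ => 2 * n + 1) (by intro a b h; simp at h; exact h)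
    refine this.congr ?_
    intro n
    simp

lemma inner_eq {x : ℝ} (h0 : 0 < x) (h1 : x < 1) :
    ∫ y in (0:ℝ)..(1 - x), x ^ 4 * y ^ 4 / (1 - x ^ 2 - y ^ 2) =
      x ^ 4 * (-(1-x)^3/3 - (1-x^2) * (1-x)
        + √(1-x^2)^3 / 2 * (Real.log (1 + √(1-x^2)) - Real.log x)) := by
  set a := √(1-x^2) with ha
  have hpos : 0 < 1 - x^2 := by nlinarith
  have ha0 : 0 < a := Real.sqrt_pos.2 hpos
  have ha2 : a^2 = 1 - x^2 := Real.sq_sqrt hpos.le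
  have hlt : 1 - x < a := by
    apply Real.lt_sqrt_of_sq_lt; nlinarith
  have hd : ∀ y ∈ Set.uIcc 0 (1-x), HasDerivAt (fun y => x^4 * (-y^3/3 - a^2 * y + a^3/2 * (Real.log (a+y) - Real.log (a-y))))
      (x ^ 4 * y ^ 4 / (1 - x ^ 2 - y ^ 2)) y := by
    intro y hy
    rw [Set.uIcc_of_le (by linarith)] at hy
    have hp : a + y ≠ 0 := by linarith [hy.1]
    have hm : a - y ≠ 0 := by linarith [hy.2]
    have hid := hasDerivAt_id' y
    have := ((((hid.pow 3).neg.div_const 3).sub (hid.const_mul (a^2))).add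
      ((((hid.const_add a).log hp).sub ((hid.const_sub a).log hm)).const_mul (a^3/2))).const_mul (x^4)
    refine this.congr_deriv ?_
    rw [show 1 - x^2 - y^2 = (a+y)*(a-y) by rw [← ha2]; ring]
    field_simp
    ring
  rw [intervalIntegral.integral_eq_sub_of_hasDerivAt hd]
  · have hl : Real.log (a + (1 - x)) - Real.log (a - (1 - x)) = Real.log (1 + a) - Real.log x := by
      rw [← Real.log_div (by linarith) (by linarith), ← Real.log_div (by linarith) (by linarith)]
      congr 1
      rw [div_eq_div_iff (by linarith) (by linarith)]
      linear_combination -ha2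
    rw [hl, ha2]
    simp
  · apply ContinuousOn.intervalIntegrable
    intro y hy
    rw [Set.uIcc_of_le (by linarith)] at hy
    have : 1 - x^2 - y^2 ≠ 0 := by
      rw [← ha2]
      have := hy.1; have := hy.2
      nlinarith
    apply ContinuousAt.continuousWithinAt
    fun_prop (disch := assumption)

noncomputable def P1 (x : ℝ) : ℝ := -3/128 - x^2/64 + 3/16*x^4 - x^6/8
noncomputable def QQ (x : ℝ) : ℝ := (-3/128*x - x^3/192 + 3/80*x^5 - x^7/56)/2 -
  (4/15*x^5 - x^6/3 + x^8/12)
noncomputable def sqa (x : ℝ) : ℝ := √(1-x^2)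
noncomputable def uu (x : ℝ) : ℝ := x / (1 + sqa x)
noncomputable def FF (x : ℝ) : ℝ := sqa x * (x * P1 x) + 3/64 * Real.arctan (uu x)
noncomputable def Phi (x : ℝ) : ℝ :=
  (FF x * Real.log (1 + sqa x) - (x * Real.log x) * (sqa x * P1 x + 3/64 * arcD (uu x) / (1 + sqa x))) / 2
   + QQ x + 3/128 * Ti (uu x)

lemma Phi_eq (x : ℝ) : Phi x = FF x * (Real.log (1 + sqa x) - Real.log x) / 2
   + QQ x + 3/128 * Ti (uu x) := by
  unfold Phi
  have : FF x = x * (sqa x * P1 x + 3/64 * arcD (uu x) / (1 + sqa x)) := by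
    unfold FF
    rw [← arcD_mul]
    have hu : uu x = x / (1 + sqa x) := rfl
    linear_combination (3/64 * arcD (uu x)) * hu
  linear_combination (Real.log x / 2) * this

lemma sqa_nonneg' (x : ℝ) : 0 ≤ sqa x := Real.sqrt_nonneg _

lemma sqa_cont : Continuous sqa := by unfold sqa; fun_prop

lemma uu_cont : Continuous uu := by
  unfold uu
  exact continuous_id.div (continuous_const.add sqa_cont) fun x => by have := sqa_nonneg' x; positivity

lemma Phi_cont : Continuous Phi := by
  have h1 := sqa_cont
  have h2 := uu_cont
  have h3 := arcD_cont
  have h4 := Ti_cont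
  have h5 := Real.continuous_mul_log
  have h6 : ∀ x, 1 + sqa x ≠ 0 := fun x => by have := sqa_nonneg' x; positivity
  have h7 : Continuous P1 := by unfold P1; fun_prop
  have h8 : Continuous QQ := by unfold QQ; fun_prop
  have h10 := Real.continuous_arctan
  have h9 : Continuous FF := by unfold FF; fun_prop
  have h11 : Continuous fun x => Real.log (1 + sqa x) := (continuous_const.add h1).log h6
  have h12 : Continuous fun x => 3/64 * arcD (uu x) / (1 + sqa x) :=
    Continuous.div (by fun_prop) (by fun_prop) h6
  unfold Phi
  fun_prop

lemma Phi_deriv {x : ℝ} (h0 : 0 < x) (h1 : x < 1) : HasDerivAt Phi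
    (x ^ 4 * (-(1-x)^3/3 - (1-x^2) * (1-x)
        + √(1-x^2)^3 / 2 * (Real.log (1 + √(1-x^2)) - Real.log x))) x := by
  have hpos : 0 < 1 - x^2 := by nlinarith
  change HasDerivAt Phi
    (x ^ 4 * (-(1-x)^3/3 - (1-x^2) * (1-x)
        + sqa x^3 / 2 * (Real.log (1 + sqa x) - Real.log x))) x
  have ha0 : 0 < sqa x := Real.sqrt_pos.2 hpos
  have ha2 : sqa x^2 = 1 - x^2 := Real.sq_sqrt hpos.le
  have hid := hasDerivAt_id' x
  have dsq : HasDerivAt sqa (-x / sqa x) x := by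
    have := ((hid.pow 2).const_sub 1).sqrt hpos.ne'
    refine this.congr_deriv ?_
    change _ / (2 * sqa x) = _
    field_simp
    norm_num
  have hx2 : x^2 = 1 - sqa x^2 := by linarith
  have duu : HasDerivAt uu (1 / (sqa x * (1 + sqa x))) x := by
    have := hid.div (dsq.const_add 1) (by positivity)
    refine this.congr_deriv ?_
    field_simp
    linear_combination ha2
  have dT : HasDerivAt (fun x => Ti (uu x)) (Real.arctan (uu x) / (x * sqa x)) x := by
    refine ((Ti_deriv (uu x)).comp x duu).congr_deriv ?_
    rw [← arcD_mul]
    nth_rw 2 [uu]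
    field_simp
  have dA : HasDerivAt (fun x => Real.arctan (uu x)) (1 / (2 * sqa x)) x := by
    refine duu.arctan.congr_deriv ?_
    have : 1 + uu x ^ 2 = 2 / (1 + sqa x) := by
      unfold uu
      field_simp
      linear_combination ha2
    rw [this]
    field_simp
  have dP : HasDerivAt (fun x => x * P1 x) (-3/128 - 3*x^2/64 + 15/16*x^4 - 7*x^6/8) x := by
    have := ((((hid.const_mul (-3/128)).sub ((hid.pow 3).div_const 64)).add ((hid.pow 5).const_mul (3/16))).sub
      ((hid.pow 7).div_const 8))
    refine (this.congr_deriv ?_).congr_of_eventuallyEq (Filter.Eventually.of_forall fun y => ?_)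
    · norm_num; ring
    · simp [P1]; ring
  have dQ : HasDerivAt QQ (P1 x / 2 - x^4 * (4/3 - 2*x + 2/3*x^3)) x := by
    have := ((((hid.const_mul (-3/128)).sub ((hid.pow 3).div_const 192)).add ((hid.pow 5).const_mul (3/80))).sub
      ((hid.pow 7).div_const 56)).div_const 2 |>.sub ((((hid.pow 5).const_mul (4/15)).sub ((hid.pow 6).div_const 3)).add
       ((hid.pow 8).div_const 12))
    refine (this.congr_deriv ?_).congr_of_eventuallyEq (Filter.Eventually.of_forall fun y => ?_)
    · simp [P1]; ring
    · simp [QQ]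
  have dF : HasDerivAt FF (x^4 * sqa x^3) x := by
    refine ((dsq.mul dP).add (dA.const_mul (3/64))).congr_deriv ?_
    have h4 : sqa x ^ 4 = (1-x^2)^2 := by rw [← ha2]; ring
    unfold P1
    field_simp
    ring_nf
    rw [h4, ha2]
    ring
  have dL : HasDerivAt (fun x => Real.log (1 + sqa x) - Real.log x) (-1/(x * sqa x)) x := by
    refine (((dsq.const_add 1).log (by positivity)).sub (hid.log h0.ne')).congr_deriv ?_
    field_simp
    linear_combination -ha2
  have := (((dF.mul dL).div_const 2).add dQ).add (dT.const_mul (3/128))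
  refine (this.congr_deriv ?_).congr_of_eventuallyEq (Filter.Eventually.of_forall fun y => Phi_eq y)
  unfold FF
  field_simp
  ring

/-- `∫_Δ x⁴y⁴/(1-x²-y²) dxdy = -569/26880 + (3/128)·G`, where `G` is the Catalan constant. -/
theorem integral_simplex_x4y4 :
    ∫ p : ℝ × ℝ in {p : ℝ × ℝ | 0 ≤ p.1 ∧ 0 ≤ p.2 ∧ 0 ≤ 1 - p.1 - p.2},
        p.1 ^ 4 * p.2 ^ 4 / (1 - p.1 ^ 2 - p.2 ^ 2) =
      -569 / 26880 + (3 / 128) * ∑' n : ℕ, (-1 : ℝ) ^ n / (2 * n + 1) ^ 2 := by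
  set S : Set (ℝ × ℝ) := {p : ℝ × ℝ | 0 ≤ p.1 ∧ 0 ≤ p.2 ∧ 0 ≤ 1 - p.1 - p.2} with hS
  set f : ℝ × ℝ → ℝ := fun p => p.1 ^ 4 * p.2 ^ 4 / (1 - p.1 ^ 2 - p.2 ^ 2) with hf
  have hSm : MeasurableSet S := by
    apply IsClosed.measurableSet
    exact (isClosed_le continuous_const continuous_fst).inter
      ((isClosed_le continuous_const continuous_snd).inter
        (isClosed_le continuous_const ((continuous_const.sub continuous_fst).sub continuous_snd)))
  have hfm : Measurable f := by unfold f; fun_prop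
  have hSfin : volume S ≠ ⊤ := by
    have : S ⊆ Set.Icc (0:ℝ×ℝ) 1 := by
      rintro ⟨x, y⟩ ⟨h1, h2, h3⟩
      simp only at h1 h2 h3
      exact ⟨⟨h1, h2⟩, ⟨by simp; linarith, by simp; linarith⟩⟩
    exact ((measure_mono this).trans_lt isCompact_Icc.measure_lt_top).ne
  have hint : IntegrableOn f S := by
    refine Measure.integrableOn_of_bounded (M := 1) hSfin hfm.aestronglyMeasurable ?_
    refine (ae_restrict_iff' hSm).2 (Filter.Eventually.of_forall ?_)
    rintro ⟨x, y⟩ ⟨h1, h2, h3⟩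
    simp only at h1 h2 h3
    have hxy : 0 ≤ x * y := mul_nonneg h1 h2
    have hd : 2 * (x * y) ≤ 1 - x^2 - y^2 := by nlinarith
    have hxy1 : x * y ≤ 1 := by nlinarith
    simp only [f]
    rw [Real.norm_of_nonneg (div_nonneg (by positivity) (by linarith))]
    apply div_le_one_of_le₀ _ (by linarith)
    have : (x*y)^4 ≤ (x * y) := pow_le_of_le_one hxy hxy1 (by norm_num)
    rw [← mul_pow]; linarith
  have hint' : Integrable (S.indicator f) (volume.prod volume) := by
    rw [← Measure.volume_eq_prod]; exact (integrable_indicator_iff hSm).2 hint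
  rw [← integral_indicator hSm, Measure.volume_eq_prod, integral_prod _ hint']
  have hin : ∀ x : ℝ, ∫ y, S.indicator f (x, y) =
      (Set.Icc (0:ℝ) 1).indicator (fun x => ∫ y in (0:ℝ)..(1-x), x ^ 4 * y ^ 4 / (1 - x ^ 2 - y ^ 2)) x := by
    intro x
    by_cases hx : x ∈ Set.Icc (0:ℝ) 1
    · rw [Set.indicator_of_mem hx, intervalIntegral.integral_of_le (by linarith [hx.2]),
        ← integral_Icc_eq_integral_Ioc, ← integral_indicator measurableSet_Icc]
      congr 1; ext y
      by_cases hy : y ∈ Set.Icc 0 (1-x)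
      · rw [Set.indicator_of_mem hy, Set.indicator_of_mem]
        exact ⟨hx.1, hy.1, by simp only; linarith [hy.2]⟩
      · rw [Set.indicator_of_notMem hy, Set.indicator_of_notMem]
        rintro ⟨_, h2, h3⟩
        exact hy ⟨h2, by simp only at h3; linarith⟩
    · rw [Set.indicator_of_notMem hx, ← integral_zero ℝ ℝ (μ := volume)]
      congr 1; ext y
      rw [Set.indicator_of_notMem]
      rintro ⟨h1, h2, h3⟩
      simp only at h1 h2 h3
      exact hx ⟨h1, by linarith⟩
  simp_rw [hin]
  rw [integral_indicator measurableSet_Icc, integral_Icc_eq_integral_Ioo,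
    setIntegral_congr_fun measurableSet_Ioo (fun x hx => inner_eq hx.1 hx.2),
    ← integral_Ioc_eq_integral_Ioo, ← intervalIntegral.integral_of_le zero_le_one,
    intervalIntegral.integral_eq_sub_of_hasDerivAt_of_le zero_le_one Phi_cont.continuousOn
      (fun x hx => Phi_deriv hx.1 hx.2)]
  · have e1 : Phi 1 = -569 / 26880 + (3 / 128) * Ti 1 := by
      have h : sqa 1 = 0 := by simp [sqa]
      rw [Phi_eq]; simp [h, uu, QQ]; norm_num
    have e0 : Phi 0 = 0 := by
      have h : sqa 0 = 1 := by simp [sqa]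
      simp [Phi, FF, uu, QQ, Ti]
    rw [e1, e0, Ti_one, sub_zero]
  · rw [intervalIntegrable_iff_integrableOn_Ioc_of_le zero_le_one]
    refine intervalIntegral.integrableOn_deriv_of_nonneg Phi_cont.continuousOn
      (fun x hx => Phi_deriv hx.1 hx.2) ?_
    intro x hx
    rw [← inner_eq hx.1 hx.2]
    refine intervalIntegral.integral_nonneg (by linarith [hx.2]) ?_
    intro y hy
    have h1 := hx.1; have h2 := hy.1; have h3 := hy.2
    refine div_nonneg (by positivity) ?_
    nlinarith [mul_nonneg h1.le h2]
end
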